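/- Let L be a real symmetric n×n matrix with eigendecomposition L = U Λ Uᵀ, U orthogonal, eigenvalues λ₁ ≤ ⋯ ≤ λₙ, g a real polynomial with g(λⱼ) ≠ 0 for 1 ≤ j ≤ k, Φ = g(L) with rows φᵢᵀ, U_k the first k columns of U, and p a probability vector with pᵢ > 0. Let ω₁,…,ω_m be drawn i.i.d. from {1,…,n} according to p, and set X = (1/m)·∑_{i=1}^{m} (U_kᵀ φ_{ωᵢ})(U_kᵀ φ_{ωᵢ})ᵀ / p_{ωᵢ}. Let μ_min = min_{1≤j≤k} g(λⱼ)², μ_max = max_{1≤j≤k} g(λⱼ)², and ζ = max_{1≤i≤n} ‖U_kᵀ φᵢ‖₂²/pᵢ. Then for any δ ∈ (0,1): P[λ_min(X) ≤ (1−δ)·μ_min] ≤ k·exp(−δ² μ_min m/(3ζ)) and P[λ_max(X) ≥ (1+δ)·μ_max] ≤ k·exp(−δ² μ_min m/(3ζ)). -/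

import Mathlib

open Matrix MeasureTheory

theorem aux_norm_exp_le {A : Type*} [NormedRing A] [NormedAlgebra ℝ A] [CompleteSpace A]
    [NormOneClass A] (a : A) : ‖NormedSpace.exp a‖ ≤ Real.exp ‖a‖ := by
  have h1 := NormedSpace.exp_series_hasSum_exp' (𝕂 := ℝ) a
  have h2 := NormedSpace.exp_series_hasSum_exp' (𝕂 := ℝ) ‖a‖
  rw [← Real.exp_eq_exp_ℝ] at h2
  rw [← h1.tsum_eq]
  refine tsum_of_norm_bounded h2 fun n => ?_
  rw [norm_smul, smul_eq_mul, Real.norm_of_nonneg (by positivity)]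
  gcongr
  exact norm_pow_le _ _

theorem aux_pow_sub_pow {A : Type*} [NormedRing A] [NormOneClass A] (x y : A) (K : ℝ)
    (hx : ‖x‖ ≤ K) (hy : ‖y‖ ≤ K) (hK : 1 ≤ K) (N : ℕ) :
    ‖x ^ N - y ^ N‖ ≤ N * ‖x - y‖ * K ^ N := by
  induction N with
  | zero => simp
  | succ N ih =>
    have e : x ^ (N+1) - y ^ (N+1) = x ^ N * (x - y) + (x ^ N - y ^ N) * y := by
      rw [pow_succ, pow_succ]; noncomm_ring
    have hxN : ‖x ^ N‖ ≤ K ^ N := (norm_pow_le _ _).trans (by gcongr)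
    calc ‖x ^ (N+1) - y ^ (N+1)‖ ≤ ‖x ^ N‖ * ‖x - y‖ + ‖x ^ N - y ^ N‖ * ‖y‖ := by
          rw [e]; exact (norm_add_le _ _).trans (add_le_add (norm_mul_le _ _) (norm_mul_le _ _))
      _ ≤ K ^ (N+1) * ‖x - y‖ + (N * ‖x - y‖ * K ^ N) * K := by
          have : K ^ N ≤ K ^ (N+1) := pow_le_pow_right₀ hK (by omega)
          gcongr
          exact hxN.trans this
      _ = _ := by push_cast; ring

open Filter Topology in
theorem aux_trotter {A : Type*} [NormedRing A] [NormedAlgebra ℝ A] [CompleteSpace A]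
    [NormOneClass A] (a b : A) :
    Tendsto (fun j : ℕ => (NormedSpace.exp (((2:ℝ)^j)⁻¹ • a) * NormedSpace.exp (((2:ℝ)^j)⁻¹ • b)) ^ (2 ^ j))
      atTop (𝓝 (NormedSpace.exp (a + b))) := by
  have hd : HasDerivAt (fun t : ℝ => NormedSpace.exp (t • a) * NormedSpace.exp (t • b)
      - NormedSpace.exp (t • (a + b))) 0 0 := by
    have := ((hasDerivAt_exp_smul_const (𝕂 := ℝ) a 0).mul (hasDerivAt_exp_smul_const (𝕂 := ℝ) b 0)).sub
      (hasDerivAt_exp_smul_const (𝕂 := ℝ) (a+b) 0)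
    simp only [zero_smul, NormedSpace.exp_zero, one_mul, mul_one, sub_self] at this
    exact this
  have hs : Tendsto (fun j : ℕ => ((2:ℝ)^j)⁻¹) atTop (𝓝[≠] 0) := by
    refine tendsto_nhdsWithin_iff.2 ⟨?_, Eventually.of_forall fun j => ?_⟩
    · exact (tendsto_pow_atTop_atTop_of_one_lt (by norm_num : (1:ℝ) < 2)).inv_tendsto_atTop
    · simp
  have h0 := (hasDerivAt_iff_tendsto_slope.1 hd).comp hs
  rw [tendsto_iff_norm_sub_tendsto_zero]
  have h1 := h0.norm.mul_const (Real.exp (‖a‖ + ‖b‖))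
  rw [norm_zero, zero_mul] at h1
  refine squeeze_zero (fun _ => norm_nonneg _) (fun j => ?_) h1
  set t : ℝ := ((2:ℝ)^j)⁻¹ with ht
  have ht0 : 0 < t := by positivity
  have hN : ((2^j : ℕ) : ℝ) * t = 1 := by rw [ht]; push_cast; field_simp
  have e1 : NormedSpace.exp (a + b) = NormedSpace.exp (t • (a + b)) ^ (2^j) := by
    let _ : NormedAlgebra ℚ A := NormedAlgebra.restrictScalars ℚ ℝ A
    rw [← NormedSpace.exp_nsmul, ← Nat.cast_smul_eq_nsmul ℝ, smul_smul, hN, one_smul]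
  have e2 : Real.exp (‖a‖ + ‖b‖) = Real.exp (t * (‖a‖ + ‖b‖)) ^ (2^j) := by
    rw [← Real.exp_nat_mul, ← mul_assoc, hN, one_mul]
  have hx : ‖NormedSpace.exp (t • a) * NormedSpace.exp (t • b)‖ ≤ Real.exp (t * (‖a‖ + ‖b‖)) := by
    refine (norm_mul_le _ _).trans ?_
    rw [mul_add, Real.exp_add]
    gcongr
    · refine (aux_norm_exp_le _).trans_eq ?_
      rw [norm_smul, Real.norm_of_nonneg ht0.le]
    · refine (aux_norm_exp_le _).trans_eq ?_
      rw [norm_smul, Real.norm_of_nonneg ht0.le]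
  have hy : ‖NormedSpace.exp (t • (a + b))‖ ≤ Real.exp (t * (‖a‖ + ‖b‖)) := by
    refine (aux_norm_exp_le _).trans ?_
    rw [norm_smul, Real.norm_of_nonneg ht0.le]
    gcongr
    exact norm_add_le _ _
  rw [e1]
  refine (aux_pow_sub_pow _ _ _ hx hy (Real.one_le_exp (by positivity)) (2^j)).trans_eq ?_
  rw [e2]
  congr 1
  simp only [Function.comp, slope_def_module, sub_zero, zero_smul, NormedSpace.exp_zero, mul_one, sub_self]
  rw [norm_smul, ← ht, Real.norm_of_nonneg (by positivity)]
  congr 1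
  exact eq_inv_of_mul_eq_one_left hN

theorem aux_tr_sq {k : ℕ} (M N : Matrix (Fin k) (Fin k) ℝ) :
    2 * (M * N).trace ≤ (M * Mᵀ).trace + (Nᵀ * N).trace := by
  have : 0 ≤ ((M - Nᵀ) * (M - Nᵀ)ᵀ).trace := by
    rw [Matrix.trace]
    refine Finset.sum_nonneg fun i _ => ?_
    rw [Matrix.diag_apply, Matrix.mul_apply]
    exact Finset.sum_nonneg fun j _ => by rw [Matrix.transpose_apply]; exact mul_self_nonneg _
  have h2 : (Nᵀ * Mᵀ).trace = (M * N).trace := by rw [← Matrix.transpose_mul, Matrix.trace_transpose]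
  simp only [Matrix.transpose_sub, Matrix.transpose_transpose, Matrix.sub_mul, Matrix.mul_sub, Matrix.trace_sub, h2] at this
  linarith

theorem aux_tr_pow_comm {k : ℕ} (A B : Matrix (Fin k) (Fin k) ℝ) (N : ℕ) :
    ((A * B) ^ N).trace = ((B * A) ^ N).trace := by
  cases N with
  | zero => simp
  | succ N =>
    rw [pow_succ', Matrix.mul_assoc, Matrix.trace_mul_comm, pow_succ]
    congr 1
    have : ∀ N, B * (A * B) ^ N = (B * A) ^ N * B := by
      intro N
      induction N with
      | zero => simp
      | succ N ih => rw [pow_succ, ← Matrix.mul_assoc, ih, pow_succ]; simp only [Matrix.mul_assoc]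
    rw [← Matrix.mul_assoc, ← this, Matrix.mul_assoc]

theorem aux_PG {k : ℕ} (j : ℕ) :
    (∀ M : Matrix (Fin k) (Fin k) ℝ, (M ^ 2 ^ (j+1)).trace ≤ ((Mᵀ * M) ^ 2 ^ j).trace) ∧
    (∀ A B : Matrix (Fin k) (Fin k) ℝ, Aᵀ = A → Bᵀ = B →
      ((A * B) ^ 2 ^ j).trace ≤ (A ^ 2 ^ j * B ^ 2 ^ j).trace) := by
  induction j with
  | zero =>
    refine ⟨fun M => ?_, fun A B _ _ => by simp⟩
    have := aux_tr_sq M M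
    rw [Matrix.trace_mul_comm M Mᵀ] at this
    simp only [zero_add, pow_one, pow_zero, pow_two]
    linarith
  | succ j ih =>
    obtain ⟨hP, hG⟩ := ih
    constructor
    · intro M
      have e : M ^ 2 ^ (j+1+1) = (M * M) ^ 2 ^ (j+1) := by rw [← pow_two, ← pow_mul]; congr 1; ring
      have h1 := hP (M * M)
      have e2 : (M * M)ᵀ * (M * M) = Mᵀ * ((Mᵀ * M) * M) := by
        rw [Matrix.transpose_mul]; simp only [Matrix.mul_assoc]
      rw [e2, aux_tr_pow_comm Mᵀ, Matrix.mul_assoc _ M Mᵀ] at h1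
      have h2 := hG (Mᵀ * M) (M * Mᵀ) (by simp) (by simp)
      have h3 := aux_tr_sq ((Mᵀ * M) ^ 2 ^ j) ((M * Mᵀ) ^ 2 ^ j)
      rw [Matrix.transpose_pow, Matrix.transpose_pow] at h3
      simp only [Matrix.transpose_mul, Matrix.transpose_transpose, ← pow_add] at h3
      rw [← two_mul, ← pow_succ', aux_tr_pow_comm M Mᵀ] at h3
      rw [e]
      linarith
    · intro A B hA hB
      have h1 := hP (A * B)
      have e2 : (A * B)ᵀ * (A * B) = B * (A * A * B) := by
        rw [Matrix.transpose_mul, hA, hB]; simp only [Matrix.mul_assoc]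
      rw [e2, aux_tr_pow_comm B, Matrix.mul_assoc _ B B] at h1
      have h2 := hG (A * A) (B * B) (by simp [hA]) (by simp [hB])
      have e : ∀ M : Matrix (Fin k) (Fin k) ℝ, M ^ 2 ^ (j+1) = (M * M) ^ 2 ^ j := by
        intro M; rw [← pow_two, ← pow_mul]; congr 1; ring
      rw [e A, e B]
      exact h1.trans h2

open Filter Topology in
theorem aux_golden_thompson {k : ℕ} (A B : Matrix (Fin k) (Fin k) ℝ) (hA : Aᵀ = A) (hB : Bᵀ = B) :
    (NormedSpace.exp (A + B)).trace ≤ (NormedSpace.exp A * NormedSpace.exp B).trace := by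
  rcases Nat.eq_zero_or_pos k with rfl | hk
  · simp [Matrix.trace]
  have : Nonempty (Fin k) := ⟨⟨0, hk⟩⟩
  have hT : Tendsto (fun j : ℕ => (NormedSpace.exp (((2:ℝ)^j)⁻¹ • A) * NormedSpace.exp (((2:ℝ)^j)⁻¹ • B)) ^ (2 ^ j))
      atTop (𝓝 (NormedSpace.exp (A + B))) := by
    open scoped Matrix.Norms.Operator in
    exact aux_trotter A B
  have hc : Continuous (fun M : Matrix (Fin k) (Fin k) ℝ => M.trace) := by fun_prop
  refine le_of_tendsto ((hc.tendsto _).comp hT) (Eventually.of_forall fun j => ?_)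
  have h := (aux_PG (k := k) j).2 (NormedSpace.exp (((2:ℝ)^j)⁻¹ • A)) (NormedSpace.exp (((2:ℝ)^j)⁻¹ • B))
    (by rw [← Matrix.exp_transpose, Matrix.transpose_smul, hA])
    (by rw [← Matrix.exp_transpose, Matrix.transpose_smul, hB])
  have e : ∀ M : Matrix (Fin k) (Fin k) ℝ, NormedSpace.exp (((2:ℝ)^j)⁻¹ • M) ^ 2 ^ j = NormedSpace.exp M := by
    intro M
    rw [← Matrix.exp_nsmul, ← Nat.cast_smul_eq_nsmul ℝ, smul_smul]
    push_cast
    rw [mul_inv_cancel₀ (by positivity), one_smul]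
  rw [e, e] at h
  exact h

theorem aux_spec {k : ℕ} (A : Matrix (Fin k) (Fin k) ℝ) (hA : A.IsHermitian) :
    ∃ V : Matrix (Fin k) (Fin k) ℝ, Vᵀ * V = 1 ∧ V * Vᵀ = 1 ∧
      A = V * Matrix.diagonal hA.eigenvalues * Vᵀ ∧
      ∀ θ : ℝ, NormedSpace.exp (θ • A) =
        V * Matrix.diagonal (fun i => Real.exp (θ * hA.eigenvalues i)) * Vᵀ := by
  refine ⟨hA.eigenvectorUnitary, ?_, ?_, ?_, ?_⟩
  · exact Unitary.coe_star_mul_self hA.eigenvectorUnitary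
  · exact Unitary.coe_mul_star_self hA.eigenvectorUnitary
  · exact hA.spectral_theorem
  · intro θ
    have h1 : (hA.eigenvectorUnitary : Matrix (Fin k) (Fin k) ℝ) *
      (hA.eigenvectorUnitary : Matrix (Fin k) (Fin k) ℝ)ᵀ = 1 := 
      Unitary.coe_mul_star_self hA.eigenvectorUnitary
    set V := (hA.eigenvectorUnitary : Matrix (Fin k) (Fin k) ℝ) with hV
    have h2 : A = V * Matrix.diagonal hA.eigenvalues * Vᵀ := hA.spectral_theorem
    have h3 : V⁻¹ = Vᵀ := Matrix.inv_eq_right_inv h1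
    have hu : IsUnit V := by
      rw [Matrix.isUnit_iff_isUnit_det]
      exact Matrix.isUnit_det_of_right_inverse h1
    have h4 : θ • A = V * Matrix.diagonal (fun i => θ * hA.eigenvalues i) * V⁻¹ := by
      have : Matrix.diagonal (fun i => θ * hA.eigenvalues i) = θ • Matrix.diagonal hA.eigenvalues := by
        rw [← Matrix.diagonal_smul]; rfl
      rw [h3, this, Matrix.mul_smul, Matrix.smul_mul]
      exact congrArg (θ • ·) h2
    rw [h4, Matrix.exp_conj _ _ hu, Matrix.exp_diagonal, h3]
    congr 3
    funext i
    rw [Pi.exp_def, Real.exp_eq_exp_ℝ]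

theorem aux_conj_psd {k : ℕ} (V : Matrix (Fin k) (Fin k) ℝ) (d : Fin k → ℝ) (hd : ∀ i, 0 ≤ d i) :
    (V * Matrix.diagonal d * Vᵀ).PosSemidef := by
  have := (Matrix.PosSemidef.diagonal (n := Fin k) (R := ℝ) (d := d) hd).mul_mul_conjTranspose_same V
  simpa [Matrix.conjTranspose_eq_transpose_of_trivial] using this

theorem aux_tr_exp {k : ℕ} (A : Matrix (Fin k) (Fin k) ℝ) (hA : A.IsHermitian) (θ : ℝ) (i : Fin k) :
    Real.exp (θ * hA.eigenvalues i) ≤ (NormedSpace.exp (θ • A)).trace := by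
  obtain ⟨V, h1, h2, h3, h4⟩ := aux_spec A hA
  rw [h4, Matrix.mul_assoc, Matrix.trace_mul_comm, Matrix.mul_assoc, h1, Matrix.mul_one, Matrix.trace_diagonal]
  exact Finset.single_le_sum (f := fun i => Real.exp (θ * hA.eigenvalues i)) (fun i _ => (Real.exp_pos _).le) (Finset.mem_univ i)

theorem aux_exp_psd {k : ℕ} (A : Matrix (Fin k) (Fin k) ℝ) (hA : A.IsHermitian) :
    (NormedSpace.exp A).PosSemidef := by
  obtain ⟨V, h1, h2, h3, h4⟩ := aux_spec A hA
  have := h4 1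
  rw [one_smul] at this
  rw [this]
  exact aux_conj_psd _ _ fun i => (Real.exp_pos _).le

theorem aux_exp_chord {k : ℕ} (A : Matrix (Fin k) (Fin k) ℝ) (hA : A.PosSemidef) (ζ θ : ℝ) (hζ : 0 < ζ)
    (htr : A.trace ≤ ζ) :
    (1 + ((Real.exp (θ * ζ) - 1) / ζ) • A - NormedSpace.exp (θ • A)).PosSemidef := by
  obtain ⟨V, h1, h2, h3, h4⟩ := aux_spec A hA.1
  set ev := hA.1.eigenvalues with hev
  have h0 : ∀ i, 0 ≤ ev i := hA.eigenvalues_nonneg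
  have hle : ∀ i, ev i ≤ ζ := by
    intro i
    have h := hA.1.trace_eq_sum_eigenvalues
    have h' : A.trace = ∑ i, ev i := by simpa using h
    exact (Finset.single_le_sum (fun i _ => h0 i) (Finset.mem_univ i)).trans (h' ▸ htr)
  set β := (Real.exp (θ * ζ) - 1) / ζ with hβ
  have e : 1 + β • A - NormedSpace.exp (θ • A) =
      V * Matrix.diagonal (fun i => 1 + β * ev i - Real.exp (θ * ev i)) * Vᵀ := by
    have : Matrix.diagonal (fun i => 1 + β * ev i - Real.exp (θ * ev i)) =
      1 + β • Matrix.diagonal ev - Matrix.diagonal (fun i => Real.exp (θ * ev i)) := by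
      ext i j
      by_cases hij : i = j
      · subst hij; simp
      · simp [hij]
    rw [this, h4, Matrix.mul_sub, Matrix.mul_add, Matrix.sub_mul, Matrix.add_mul, Matrix.mul_one, h2,
      Matrix.mul_smul, Matrix.smul_mul]
    congr 2
    exact congrArg (β • ·) h3
  rw [e]
  refine aux_conj_psd _ _ fun i => ?_
  have ha : 0 ≤ 1 - ev i / ζ := by rw [sub_nonneg, div_le_one hζ]; exact hle i
  have hc := convexOn_exp.2 (Set.mem_univ (0:ℝ)) (Set.mem_univ (θ * ζ)) ha
    (div_nonneg (h0 i) hζ.le) (by ring)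
  simp only [smul_eq_mul, mul_zero, zero_add, Real.exp_zero, mul_one] at hc
  have e1 : ev i / ζ * (θ * ζ) = θ * ev i := by field_simp
  rw [e1] at hc
  have e2 : β * ev i = ev i / ζ * Real.exp (θ * ζ) - ev i / ζ := by rw [hβ]; ring
  rw [e2]
  linarith

theorem aux_tr_mul_nonneg {k : ℕ} (A B : Matrix (Fin k) (Fin k) ℝ) (hA : A.PosSemidef) (hB : B.PosSemidef) :
    0 ≤ (A * B).trace := by
  obtain ⟨V, h1, h2, h3, h4⟩ := aux_spec A hA.1
  have hd := hA.eigenvalues_nonneg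
  have h5 : (Vᵀ * B * V).PosSemidef := by
    have := hB.conjTranspose_mul_mul_same V
    simpa [Matrix.conjTranspose_eq_transpose_of_trivial] using this
  have : (A * B).trace = (Matrix.diagonal hA.1.eigenvalues * (Vᵀ * B * V)).trace := by
    conv_lhs => rw [h3]
    rw [Matrix.mul_assoc, Matrix.mul_assoc, Matrix.trace_mul_comm]
    simp only [Matrix.mul_assoc]
  rw [this, Matrix.trace]
  refine Finset.sum_nonneg fun i _ => ?_
  rw [Matrix.diag_apply, Matrix.diagonal_mul]
  exact mul_nonneg (hd i) h5.diag_nonneg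

theorem aux_mgf {n k : ℕ} (p : Fin n → ℝ) (hp : ∀ i, 0 < p i) (Y : Fin n → Matrix (Fin k) (Fin k) ℝ)
    (hY : ∀ a, (Y a)ᵀ = Y a) (c : ℝ) (hc : 0 ≤ c)
    (hW : (c • (1 : Matrix (Fin k) (Fin k) ℝ) - ∑ a, p a • NormedSpace.exp (Y a)).PosSemidef) (m : ℕ) :
    ∑ ω : Fin m → Fin n, (∏ i, p (ω i)) * (NormedSpace.exp (∑ i, Y (ω i))).trace ≤ k * c ^ m := by
  induction m with
  | zero => simp
  | succ m ih =>
    rw [← (Fin.consEquiv (fun _ : Fin (m+1) => Fin n)).sum_comp, Fintype.sum_prod_type, Finset.sum_comm]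
    have key : ∀ ω : Fin m → Fin n, ∑ a : Fin n, (∏ i, p ((Fin.consEquiv (fun _ : Fin (m+1) => Fin n)) (a, ω) i)) *
        (NormedSpace.exp (∑ i, Y ((Fin.consEquiv (fun _ : Fin (m+1) => Fin n)) (a, ω) i))).trace ≤
        c * ((∏ i, p (ω i)) * (NormedSpace.exp (∑ i, Y (ω i))).trace) := by
      intro ω
      simp only [Fin.consEquiv_apply, Fin.prod_univ_succ, Fin.sum_univ_succ, Fin.cons_zero, Fin.cons_succ]
      set S := ∑ i, Y (ω i) with hS
      have hSt : Sᵀ = S := by rw [hS, Matrix.transpose_sum]; simp only [hY]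
      have hP : 0 ≤ ∏ i, p (ω i) := Finset.prod_nonneg fun i _ => (hp _).le
      have h1 := aux_tr_mul_nonneg _ _ (aux_exp_psd S (by
        rw [Matrix.IsHermitian, Matrix.conjTranspose_eq_transpose_of_trivial, hSt])) hW
      rw [Matrix.mul_sub, Matrix.trace_sub, Matrix.mul_smul, Matrix.mul_one, Matrix.trace_smul, smul_eq_mul,
        Matrix.mul_sum, Matrix.trace_sum] at h1
      calc _ ≤ ∑ a, (∏ i, p (ω i)) * (NormedSpace.exp S * p a • NormedSpace.exp (Y a)).trace := by
            refine Finset.sum_le_sum fun a _ => ?_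
            have := aux_golden_thompson S (Y a) hSt (hY a)
            rw [Matrix.mul_smul, Matrix.trace_smul, smul_eq_mul, add_comm (Y a) S, mul_comm (p a), mul_assoc]
            have := (hp a).le
            gcongr
        _ ≤ _ := by
            rw [← Finset.mul_sum, mul_left_comm]
            gcongr
            linarith
    refine (Finset.sum_le_sum fun ω _ => key ω).trans ?_
    rw [← Finset.mul_sum, pow_succ']
    calc _ ≤ c * (k * c ^ m) := by gcongr
      _ = _ := by ring

theorem aux_markov {n m : ℕ} (p : Fin n → ℝ) (hp : ∀ i, 0 < p i)
    (ν : Measure (Fin n)) [IsProbabilityMeasure ν] (hν : ∀ i : Fin n, ν {i} = ENNReal.ofReal (p i))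
    (f : (Fin m → Fin n) → ℝ) (hf : ∀ ω, 0 ≤ f ω) (S : Set (Fin m → Fin n)) (T : ℝ) (hT : 0 < T)
    (hS : ∀ ω ∈ S, T ≤ f ω) (B : ℝ) (hB : (∑ ω, (∏ i, p (ω i)) * f ω) ≤ B * T) :
    (Measure.pi fun _ : Fin m => ν) S ≤ ENNReal.ofReal B := by
  classical
  have hw : ∀ ω : Fin m → Fin n, 0 ≤ ∏ i, p (ω i) := fun ω => Finset.prod_nonneg fun i _ => (hp _).le
  have e : (Measure.pi fun _ : Fin m => ν) S = ENNReal.ofReal (∑ ω ∈ S.toFinset, ∏ i, p (ω i)) := by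
    conv_lhs => rw [← Set.coe_toFinset S]
    rw [← sum_measure_singleton, ENNReal.ofReal_sum_of_nonneg fun ω _ => hw ω]
    refine Finset.sum_congr rfl fun ω _ => ?_
    rw [Measure.pi_singleton, ENNReal.ofReal_prod_of_nonneg fun i _ => (hp _).le]
    simp only [hν]
  rw [e]
  refine ENNReal.ofReal_le_ofReal ?_
  rw [← mul_le_mul_iff_left₀ hT]
  refine le_trans ?_ hB
  rw [Finset.sum_mul]
  refine (Finset.sum_le_sum fun ω hω => mul_le_mul_of_nonneg_left (hS ω (by simpa using hω)) (hw ω)).trans ?_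
  exact Finset.sum_le_sum_of_subset_of_nonneg (Finset.subset_univ _) fun ω _ _ => mul_nonneg (hw ω) (hf ω)

theorem aux_num1 (δ : ℝ) (h0 : 0 < δ) (h1 : δ < 1) : δ - (1+δ) * Real.log (1+δ) ≤ -(δ^2)/3 := by
  have h := Real.le_log_one_add_of_nonneg h0.le
  have : (1+δ) * (2*δ/(δ+2)) ≤ (1+δ) * Real.log (1+δ) := by gcongr
  have e : (1+δ) * (2*δ/(δ+2)) - δ = δ^2/(δ+2) := by field_simp; ring
  have : δ^2/3 ≤ δ^2/(δ+2) := by gcongr; linarith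
  linarith

theorem aux_num2 (δ : ℝ) (h0 : 0 < δ) (h1 : δ < 1) : -δ - (1-δ) * Real.log (1-δ) ≤ -(δ^2)/3 := by
  have hp : 0 < 1 - δ := by linarith
  have h := Real.self_le_sinh_iff.2 (neg_nonneg.2 (Real.log_neg hp (by linarith)).le)
  rw [Real.sinh_eq, neg_neg, Real.exp_neg, Real.exp_log hp] at h
  have h2 := mul_le_mul_of_nonneg_left h hp.le
  have e : (1-δ) * (((1-δ)⁻¹ - (1-δ))/2) = (1 - (1-δ)^2)/2 := by field_simp
  rw [e] at h2
  nlinarith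

theorem aux_tail {n k m : ℕ} (p : Fin n → ℝ) (hp : ∀ i, 0 < p i) (hp1 : ∑ i, p i = 1)
    (ν : Measure (Fin n)) [IsProbabilityMeasure ν] (hν : ∀ i : Fin n, ν {i} = ENNReal.ofReal (p i))
    (Z : Fin n → Matrix (Fin k) (Fin k) ℝ) (hZ : ∀ a, (Z a).PosSemidef) (ζ : ℝ) (hζ : 0 < ζ)
    (htr : ∀ a, (Z a).trace ≤ ζ) (d : Fin k → ℝ) (hd : ∑ a, p a • Z a = Matrix.diagonal d)
    (X : (Fin m → Fin n) → Matrix (Fin k) (Fin k) ℝ)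
    (hX : ∀ ω, X ω = (1 / (m : ℝ)) • ∑ i, Z (ω i)) (hXh : ∀ ω, (X ω).IsHermitian)
    (θ β μ τ : ℝ) (hβ : β = (Real.exp (θ * ζ) - 1) / ζ) (hμ : ∀ j, β * d j ≤ β * μ) (j0 : Fin k)
    (S : Set (Fin m → Fin n)) (hS : ∀ ω ∈ S, ∃ i, τ ≤ (θ * m) * (hXh ω).eigenvalues i) :
    (Measure.pi fun _ : Fin m => ν) S ≤ ENNReal.ofReal (k * Real.exp (m * (β * μ) - τ)) := by
  have hW : ((1 + β * μ) • (1 : Matrix (Fin k) (Fin k) ℝ) - ∑ a, p a • NormedSpace.exp (θ • Z a)).PosSemidef := by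
    have e : (1 + β * μ) • (1 : Matrix (Fin k) (Fin k) ℝ) - ∑ a, p a • NormedSpace.exp (θ • Z a) =
        ∑ a, p a • (1 + ((Real.exp (θ * ζ) - 1) / ζ) • Z a - NormedSpace.exp (θ • Z a)) +
        Matrix.diagonal (fun j => β * μ - β * d j) := by
      have e1 : Matrix.diagonal (fun j => β * μ - β * d j) = (β * μ) • (1 : Matrix (Fin k) (Fin k) ℝ) -
          β • Matrix.diagonal d := by
        ext i j
        by_cases hij : i = j
        · subst hij; simp
        · simp [hij]
      rw [e1, ← hd, ← hβ]
      simp only [smul_sub, smul_add, Finset.sum_sub_distrib, Finset.sum_add_distrib, Finset.smul_sum]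
      rw [← Finset.sum_smul, hp1]
      simp only [smul_comm β]
      rw [add_smul]
      abel
    rw [e]
    refine Matrix.PosSemidef.add (Matrix.posSemidef_sum _ fun a _ => ?_) (Matrix.PosSemidef.diagonal fun j => ?_)
    · exact (aux_exp_chord (Z a) (hZ a) ζ θ hζ (htr a)).smul (hp a).le
    · exact sub_nonneg.2 (hμ j)
  have hYh : ∀ a, (θ • Z a)ᵀ = θ • Z a := by
    intro a
    have := (hZ a).1
    rw [Matrix.IsHermitian, Matrix.conjTranspose_eq_transpose_of_trivial] at this
    rw [Matrix.transpose_smul, this]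
  have hc : 0 ≤ 1 + β * μ := by
    have hW2 : (∑ a, p a • NormedSpace.exp (θ • Z a)).PosSemidef :=
      Matrix.posSemidef_sum _ fun a _ => (aux_exp_psd _ (by
        rw [Matrix.IsHermitian, Matrix.conjTranspose_eq_transpose_of_trivial, hYh])).smul (hp a).le
    have h := (hW.add hW2).diag_nonneg (i := j0)
    simpa using h
  have hmgf := aux_mgf p hp (fun a => θ • Z a) hYh (1 + β * μ) hc hW m
  have hXS : ∀ ω, (∑ i, θ • Z (ω i)) = (θ * m) • X ω := by
    intro ω
    rw [hX, smul_smul, ← Finset.smul_sum]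
    rcases Nat.eq_zero_or_pos m with rfl | hm
    · simp
    · congr 1
      field_simp
  have hge : ∀ ω i, Real.exp ((θ * m) * (hXh ω).eigenvalues i) ≤ (NormedSpace.exp (∑ i, θ • Z (ω i))).trace := by
    intro ω i
    rw [hXS]
    exact aux_tr_exp _ _ _ _
  refine aux_markov p hp ν hν (fun ω => (NormedSpace.exp (∑ i, θ • Z (ω i))).trace)
    (fun ω => (Real.exp_pos _).le.trans (hge ω j0)) S (Real.exp τ) (Real.exp_pos _) ?_ _ ?_
  · intro ω hω
    obtain ⟨i, hi⟩ := hS ω hω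
    exact (Real.exp_le_exp.2 hi).trans (hge ω i)
  · refine hmgf.trans ?_
    rw [mul_assoc, ← Real.exp_add, sub_add_cancel, Real.exp_nat_mul]
    gcongr
    linarith [Real.add_one_le_exp (β * μ)]

theorem aux_aeval_conj {n : ℕ} (U : Matrix (Fin n) (Fin n) ℝ) (lam : Fin n → ℝ)
    (hU : Uᵀ * U = 1) (hU' : U * Uᵀ = 1) (g : Polynomial ℝ) :
    Polynomial.aeval (U * Matrix.diagonal lam * Uᵀ) g = U * Matrix.diagonal (fun i => g.eval (lam i)) * Uᵀ := by
  induction g using Polynomial.induction_on' with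
  | add p q hp hq =>
    have : Matrix.diagonal (fun i => (p + q).eval (lam i)) =
      Matrix.diagonal (fun i => p.eval (lam i)) + Matrix.diagonal (fun i => q.eval (lam i)) := by
      rw [Matrix.diagonal_add]; simp
    rw [map_add, hp, hq, this, Matrix.mul_add, Matrix.add_mul]
  | monomial N a =>
    have hpow : ∀ N, (U * Matrix.diagonal lam * Uᵀ) ^ N = U * Matrix.diagonal (fun i => lam i ^ N) * Uᵀ := by
      intro N
      induction N with
      | zero => simp [hU']
      | succ N ih =>
        rw [pow_succ, ih]
        have : Matrix.diagonal (fun i => lam i ^ (N+1)) = Matrix.diagonal (fun i => lam i ^ N) * Matrix.diagonal lam := by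
          rw [Matrix.diagonal_mul_diagonal]; simp [pow_succ]
        rw [this]
        calc _ = U * Matrix.diagonal (fun i => lam i ^ N) * (Uᵀ * U) * Matrix.diagonal lam * Uᵀ := by
              simp only [Matrix.mul_assoc]
          _ = _ := by rw [hU, Matrix.mul_one]; simp only [Matrix.mul_assoc]
    have : Matrix.diagonal (fun i => (Polynomial.monomial N a).eval (lam i)) = a • Matrix.diagonal (fun i => lam i ^ N) := by
      rw [← Matrix.diagonal_smul]
      congr 1; funext i; simp
    rw [Polynomial.aeval_monomial, hpow, this, Matrix.mul_smul, Matrix.smul_mul, Algebra.smul_def]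

theorem aux_gram {n k : ℕ} (hk : k ≤ n) (U : Matrix (Fin n) (Fin n) ℝ) (e : Fin n → ℝ)
    (hU : Uᵀ * U = 1) (Φ : Matrix (Fin n) (Fin n) ℝ) (hΦ : Φ = U * Matrix.diagonal e * Uᵀ)
    (Uk : Matrix (Fin n) (Fin k) ℝ) (hUk : Uk = U.submatrix id (Fin.castLE hk)) :
    ∑ a, Matrix.vecMulVec (Ukᵀ *ᵥ Φ a) (Ukᵀ *ᵥ Φ a) =
      Matrix.diagonal (fun j : Fin k => e (Fin.castLE hk j) ^ 2) := by
  have hΦU : Φ * U = U * Matrix.diagonal e := by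
    rw [hΦ, Matrix.mul_assoc, hU, Matrix.mul_one]
  have hv : ∀ a j, (Ukᵀ *ᵥ Φ a) j = U a (Fin.castLE hk j) * e (Fin.castLE hk j) := by
    intro a j
    have := congrFun (congrFun hΦU a) (Fin.castLE hk j)
    rw [Matrix.mul_diagonal, Matrix.mul_apply] at this
    rw [← this, hUk, Matrix.mulVec, dotProduct]
    refine Finset.sum_congr rfl fun i _ => ?_
    simp [mul_comm]
  ext i j
  rw [Matrix.sum_apply]
  simp only [Matrix.vecMulVec_apply, hv]
  have := congrFun (congrFun hU (Fin.castLE hk i)) (Fin.castLE hk j)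
  rw [Matrix.mul_apply] at this
  simp only [Matrix.transpose_apply] at this
  have e1 : ∀ a, U a (Fin.castLE hk i) * e (Fin.castLE hk i) * (U a (Fin.castLE hk j) * e (Fin.castLE hk j)) =
    U a (Fin.castLE hk i) * U a (Fin.castLE hk j) * (e (Fin.castLE hk i) * e (Fin.castLE hk j)) := by
    intro a; ring
  simp only [e1]
  rw [← Finset.sum_mul, this]
  by_cases hij : i = j
  · subst hij; simp [pow_two]
  · have : Fin.castLE hk i ≠ Fin.castLE hk j := fun h => hij (Fin.castLE_injective hk h)
    simp [hij, this]



/-- Matrix Chernoff tail bounds for the random Gram matrix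
`X = (1/m) ∑ᵢ (U_kᵀφ_{ωᵢ})(U_kᵀφ_{ωᵢ})ᵀ/p_{ωᵢ}` of the locally weighted random sampling
scheme: `P[λ_min(X) ≤ (1−δ)μ_min] ≤ k·exp(−δ²μ_min m/(3ζ))` and
`P[λ_max(X) ≥ (1+δ)μ_max] ≤ k·exp(−δ²μ_min m/(3ζ))`. -/
theorem matrix_chernoff_tail_bounds (n k m : ℕ) (hk : k ≤ n)
    (L U : Matrix (Fin n) (Fin n) ℝ) (lam : Fin n → ℝ) (hmono : Monotone lam)
    (hU : Uᵀ * U = 1) (hU' : U * Uᵀ = 1)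
    (hL : L = U * Matrix.diagonal lam * Uᵀ)
    (g : Polynomial ℝ) (hg : ∀ j : Fin k, g.eval (lam (Fin.castLE hk j)) ≠ 0)
    (Φ : Matrix (Fin n) (Fin n) ℝ) (hΦ : Φ = Polynomial.aeval L g)
    (Uk : Matrix (Fin n) (Fin k) ℝ) (hUk : Uk = U.submatrix id (Fin.castLE hk))
    (p : Fin n → ℝ) (hp : ∀ i, 0 < p i) (hp1 : ∑ i, p i = 1)
    (μmin μmax ζ : ℝ)
    (hμmin : μmin = ⨅ j : Fin k, (g.eval (lam (Fin.castLE hk j))) ^ 2)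
    (hμmax : μmax = ⨆ j : Fin k, (g.eval (lam (Fin.castLE hk j))) ^ 2)
    (hζ : ζ = ⨆ i : Fin n, (∑ j : Fin k, ((Ukᵀ *ᵥ Φ i) j) ^ 2) / p i)
    (ν : Measure (Fin n)) [IsProbabilityMeasure ν]
    (hν : ∀ i : Fin n, ν {i} = ENNReal.ofReal (p i))
    (X : (Fin m → Fin n) → Matrix (Fin k) (Fin k) ℝ)
    (hX : ∀ ω : Fin m → Fin n, X ω = (1 / (m : ℝ)) •
      ∑ i : Fin m, (p (ω i))⁻¹ • Matrix.vecMulVec (Ukᵀ *ᵥ Φ (ω i)) (Ukᵀ *ᵥ Φ (ω i)))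
    (hXh : ∀ ω : Fin m → Fin n, (X ω).IsHermitian)
    (δ : ℝ) (hδ : δ ∈ Set.Ioo (0 : ℝ) 1) :
    (Measure.pi fun _ : Fin m => ν)
        {ω : Fin m → Fin n | ∃ i0 : Fin k, (hXh ω).eigenvalues i0 ≤ (1 - δ) * μmin} ≤
      ENNReal.ofReal ((k : ℝ) * Real.exp (-(δ ^ 2) * μmin * m / (3 * ζ))) ∧
    (Measure.pi fun _ : Fin m => ν)
        {ω : Fin m → Fin n | ∃ i0 : Fin k, (1 + δ) * μmax ≤ (hXh ω).eigenvalues i0} ≤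
      ENNReal.ofReal ((k : ℝ) * Real.exp (-(δ ^ 2) * μmin * m / (3 * ζ))) := by
  have hδ0 := hδ.1
  have hδ1 := hδ.2
  rcases Nat.eq_zero_or_pos k with rfl | hkpos
  · simp
  have j0 : Fin k := ⟨0, hkpos⟩
  have hne : Nonempty (Fin k) := ⟨j0⟩
  set d : Fin k → ℝ := fun j => (g.eval (lam (Fin.castLE hk j))) ^ 2 with hd
  set Z : Fin n → Matrix (Fin k) (Fin k) ℝ := fun a =>
    (p a)⁻¹ • Matrix.vecMulVec (Ukᵀ *ᵥ Φ a) (Ukᵀ *ᵥ Φ a) with hZdef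
  have hZ : ∀ a, (Z a).PosSemidef := by
    intro a
    have := Matrix.posSemidef_vecMulVec_self_star (Ukᵀ *ᵥ Φ a)
    rw [star_trivial] at this
    exact this.smul (inv_nonneg.2 (hp a).le)
  have htr : ∀ a, (Z a).trace ≤ ζ := by
    intro a
    have e : (Z a).trace = (∑ j : Fin k, ((Ukᵀ *ᵥ Φ a) j) ^ 2) / p a := by
      rw [hZdef]
      simp only [Matrix.trace_smul, Matrix.trace_vecMulVec, smul_eq_mul, dotProduct, pow_two]
      rw [div_eq_inv_mul]
    rw [e, hζ]
    exact le_ciSup (f := fun i : Fin n => (∑ j : Fin k, ((Ukᵀ *ᵥ Φ i) j) ^ 2) / p i)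
      (Set.finite_range _).bddAbove a
  have hsum : ∑ a, p a • Z a = Matrix.diagonal d := by
    have h := aux_gram hk U (fun i => g.eval (lam i)) hU Φ
      (by rw [hΦ, hL, aux_aeval_conj U lam hU hU' g]) Uk hUk
    rw [← h]
    refine Finset.sum_congr rfl fun a _ => ?_
    rw [hZdef, smul_smul, mul_inv_cancel₀ (hp a).ne', one_smul]
  have hdpos : ∀ j, 0 < d j := fun j => by
    have := hg j
    positivity
  have hζ0 : 0 < ζ := by
    have h1 : ∑ a, p a * (Z a).trace = ∑ j, d j := by
      have := congrArg Matrix.trace hsum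
      rw [Matrix.trace_sum, Matrix.trace_diagonal] at this
      simpa only [Matrix.trace_smul, smul_eq_mul] using this
    have h2 : ∑ a, p a * (Z a).trace ≤ ∑ a, p a * ζ :=
      Finset.sum_le_sum fun a _ => mul_le_mul_of_nonneg_left (htr a) (hp a).le
    rw [← Finset.sum_mul, hp1, one_mul, h1] at h2
    exact (Finset.sum_pos (fun j _ => hdpos j) Finset.univ_nonempty).trans_le h2
  have hmin : ∀ j, μmin ≤ d j := fun j => by
    rw [hμmin]; exact ciInf_le (Set.finite_range _).bddBelow j
  have hmax : ∀ j, d j ≤ μmax := fun j => by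
    rw [hμmax]; exact le_ciSup (Set.finite_range _).bddAbove j
  have hmin0 : 0 ≤ μmin := by
    rw [hμmin]; exact le_ciInf fun j => (hdpos j).le
  have hmm : μmin ≤ μmax := (hmin j0).trans (hmax j0)
  have hm0 : (0:ℝ) ≤ m := Nat.cast_nonneg m
  constructor
  · have hlog : Real.log (1 - δ) < 0 := Real.log_neg (by linarith) (by linarith)
    refine (aux_tail p hp hp1 ν hν Z hZ ζ hζ0 htr d hsum X hX hXh (Real.log (1 - δ) / ζ) (-δ / ζ) μmin
      (Real.log (1 - δ) / ζ * m * ((1 - δ) * μmin)) ?_ ?_ j0 _ ?_).trans ?_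
    · rw [div_mul_cancel₀ _ hζ0.ne', Real.exp_log (by linarith)]
      ring
    · intro j
      exact mul_le_mul_of_nonpos_left (hmin j) (div_nonpos_of_nonpos_of_nonneg (by linarith) hζ0.le)
    · rintro ω ⟨i, hi⟩
      exact ⟨i, mul_le_mul_of_nonpos_left hi
        (mul_nonpos_of_nonpos_of_nonneg (div_nonpos_of_nonpos_of_nonneg hlog.le hζ0.le) hm0)⟩
    · refine ENNReal.ofReal_le_ofReal ?_
      gcongr
      have h := mul_le_mul_of_nonneg_left (aux_num2 δ hδ0 hδ1) (show 0 ≤ m * μmin / ζ by positivity)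
      calc _ = m * μmin / ζ * (-δ - (1-δ) * Real.log (1-δ)) := by ring
        _ ≤ _ := h
        _ = _ := by field_simp
  · have hlog : 0 < Real.log (1 + δ) := Real.log_pos (by linarith)
    refine (aux_tail p hp hp1 ν hν Z hZ ζ hζ0 htr d hsum X hX hXh (Real.log (1 + δ) / ζ) (δ / ζ) μmax
      (Real.log (1 + δ) / ζ * m * ((1 + δ) * μmax)) ?_ ?_ j0 _ ?_).trans ?_
    · rw [div_mul_cancel₀ _ hζ0.ne', Real.exp_log (by linarith)]
      ring
    · intro j
      exact mul_le_mul_of_nonneg_left (hmax j) (by positivity)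
    · rintro ω ⟨i, hi⟩
      exact ⟨i, mul_le_mul_of_nonneg_left hi (by positivity)⟩
    · refine ENNReal.ofReal_le_ofReal ?_
      gcongr
      have hmax0 := hmin0.trans hmm
      have h := mul_le_mul_of_nonneg_left (aux_num1 δ hδ0 hδ1) (show 0 ≤ m * μmax / ζ by positivity)
      have h2 : m * μmin / ζ ≤ m * μmax / ζ := by gcongr
      have h3 := mul_le_mul_of_nonpos_right h2 (show -(δ^2)/3 ≤ 0 by have := sq_nonneg δ; linarith)
      calc _ = m * μmax / ζ * (δ - (1+δ) * Real.log (1+δ)) := by ring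
        _ ≤ _ := h
        _ ≤ _ := h3
        _ = _ := by field_simp
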